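/- Let 𝒳, 𝒴 be real Banach spaces and let f : 𝒳 → 𝒴 be continuously differentiable on a neighbourhood of 0, with f(0) = 0, mapping bounded sets to bounded sets. Then ‖f‖_r / r converges to ‖Df(0)‖ as r tends to 0 from the right, where Df(0) denotes the Fréchet derivative of f at 0. -/

import Mathlib

open Filter Topology

/-- For normed spaces `X`, `Y`, a function `h : X → Y` and `r ≥ 0`,
`‖h‖_r = sup_{‖x‖ ≤ r} ‖h x‖`. -/
noncomputable def ballSupNorm {X Y : Type*} [NormedAddCommGroup X] [NormedAddCommGroup Y]
    (h : X → Y) (r : ℝ) : ℝ :=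
  sSup ((fun x => ‖h x‖) '' Metric.closedBall (0 : X) r)

theorem norm_le_ballSupNorm {X Y : Type*} [NormedAddCommGroup X] [NormedAddCommGroup Y]
    {f : X → Y} {r : ℝ} (hf : Bornology.IsBounded (f '' Metric.closedBall 0 r))
    {x : X} (hx : ‖x‖ ≤ r) : ‖f x‖ ≤ ballSupNorm f r := by
  obtain ⟨C, hC⟩ := hf.exists_norm_le
  refine le_csSup ⟨C, ?_⟩ ⟨x, mem_closedBall_zero_iff.2 hx, rfl⟩
  rintro _ ⟨y, hy, rfl⟩
  exact hC _ ⟨y, hy, rfl⟩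

theorem ballSupNorm_le_opNorm_add {X Y : Type*} [NormedAddCommGroup X] [NormedSpace ℝ X]
    [NormedAddCommGroup Y] [NormedSpace ℝ Y] {f : X → Y} (A : X →L[ℝ] Y) {r c : ℝ} (hr : 0 < r)
    (hA : ∀ x, ‖x‖ ≤ r → ‖f x - A x‖ ≤ c * r) : ballSupNorm f r ≤ (‖A‖ + c) * r := by
  refine csSup_le ((Metric.nonempty_closedBall.2 hr.le).image _) ?_
  rintro _ ⟨x, hx, rfl⟩
  have hx := mem_closedBall_zero_iff.1 hx
  have h₁ := norm_le_norm_add_norm_sub' (f x) (A x)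
  have h₂ := A.le_opNorm_of_le hx
  dsimp only
  linarith [hA x hx]

theorem opNorm_le_ballSupNorm_div_add {X Y : Type*} [NormedAddCommGroup X] [NormedSpace ℝ X]
    [NormedAddCommGroup Y] [NormedSpace ℝ Y] {f : X → Y} (A : X →L[ℝ] Y) {r c : ℝ} (hr : 0 < r)
    (hf : Bornology.IsBounded (f '' Metric.closedBall 0 r))
    (hA : ∀ x, ‖x‖ ≤ r → ‖f x - A x‖ ≤ c * r) : ‖A‖ ≤ ballSupNorm f r / r + c := by
  have hbound : ∀ x, ‖x‖ ≤ r → ‖A x‖ ≤ (ballSupNorm f r / r + c) * r := fun x hx ↦ by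
    rw [add_mul, div_mul_cancel₀ _ hr.ne']
    have h := norm_le_norm_add_norm_sub (f x) (A x)
    linarith [hA x hx, norm_le_ballSupNorm hf hx]
  have hnonneg : 0 ≤ ballSupNorm f r / r + c := by
    have h := hbound 0 (by simpa using hr.le)
    rw [map_zero, norm_zero] at h
    exact nonneg_of_mul_nonneg_left h hr
  refine A.opNorm_le_of_unit_norm hnonneg fun x hx ↦ ?_
  have hxr : ‖r • x‖ = r := by rw [norm_smul, hx, mul_one, Real.norm_of_nonneg hr.le]
  have h := hbound (r • x) hxr.le
  rw [map_smul, norm_smul, Real.norm_of_nonneg hr.le, mul_comm] at h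
  exact le_of_mul_le_mul_right h hr

/-- Let `𝒳, 𝒴` be real Banach spaces and `f : 𝒳 → 𝒴` continuously differentiable near `0`
with `f 0 = 0`, mapping bounded sets to bounded sets.  Then `‖f‖_r / r → ‖Df(0)‖` as
`r → 0⁺`. -/
theorem tendsto_ballSupNorm_div_radius_nhds_norm_fderiv
    {𝒳 𝒴 : Type*}
    [NormedAddCommGroup 𝒳] [NormedSpace ℝ 𝒳] [CompleteSpace 𝒳]
    [NormedAddCommGroup 𝒴] [NormedSpace ℝ 𝒴] [CompleteSpace 𝒴]
    (f : 𝒳 → 𝒴)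
    (hf : ∃ U ∈ 𝓝 (0 : 𝒳), IsOpen U ∧ ContDiffOn ℝ 1 f U) (hf0 : f 0 = 0)
    (hfb : ∀ s : Set 𝒳, Bornology.IsBounded s → Bornology.IsBounded (f '' s)) :
    Filter.Tendsto (fun r : ℝ => ballSupNorm f r / r) (𝓝[>] (0 : ℝ))
      (𝓝 ‖fderiv ℝ f 0‖) := by
  obtain ⟨U, hU, -, hfU⟩ := hf
  have hderiv : HasFDerivAt f (fderiv ℝ f 0) 0 :=
    ((hfU.contDiffAt hU).differentiableAt one_ne_zero).hasFDerivAt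
  rw [Metric.tendsto_nhds]
  intro ε hε
  obtain ⟨δ, hδ, hball⟩ := Metric.eventually_nhds_iff_ball.1 (hderiv.isLittleO.def (half_pos hε))
  filter_upwards [Ioo_mem_nhdsGT hδ] with r hr
  have happrox : ∀ x : 𝒳, ‖x‖ ≤ r → ‖f x - fderiv ℝ f 0 x‖ ≤ ε / 2 * r := fun x hx ↦ by
    have h := hball x (mem_ball_zero_iff.2 (hx.trans_lt hr.2))
    simp only [hf0, sub_zero] at h
    exact h.trans (by gcongr)
  have hupper := ballSupNorm_le_opNorm_add (fderiv ℝ f 0) hr.1 happrox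
  have hlower := opNorm_le_ballSupNorm_div_add (fderiv ℝ f 0) hr.1
    (hfb _ Metric.isBounded_closedBall) happrox
  have hupper' : ballSupNorm f r / r ≤ ‖fderiv ℝ f 0‖ + ε / 2 := (div_le_iff₀ hr.1).2 hupper
  rw [Real.dist_eq, abs_lt]
  constructor <;> linarith
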